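/- For every real number x > 1 and every a with 0 < a < 1, setting κ = sqrt(1-a) and ν = sqrt(1-a^2)/a, one has sqrt((x + a*x^2)/(x + a)) > 1 + κ*(x-1)/(ν*sqrt(x+a)). -/

import Mathlib

theorem M_gt_one_add (a x : ℝ) (ha : 0 < a) (ha1 : a < 1) (hx : 1 < x) :
    Real.sqrt ((x + a * x ^ 2) / (x + a)) >
      1 + Real.sqrt (1 - a) * (x - 1) / (Real.sqrt (1 - a ^ 2) / a * Real.sqrt (x + a)) := by
  obtain ⟨s, hs, hxs⟩ : ∃ s : ℝ, 1 < s ∧ x = (1 + a) * s ^ 2 - a := by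
    refine ⟨√((x + a) / (1 + a)), ?_, ?_⟩
    · rw [Real.lt_sqrt zero_le_one, one_pow, one_lt_div (by linarith)]
      linarith
    · rw [Real.sq_sqrt (by positivity)]
      field_simp
      ring
  have hs0 : 0 < s := by linarith
  have hk : 0 < √(1 - a) := Real.sqrt_pos.2 (by linarith)
  have hc : 0 < √(1 + a) := Real.sqrt_pos.2 (by linarith)
  have hc2 : √(1 + a) ^ 2 = 1 + a := Real.sq_sqrt (by linarith)
  have hn : √(1 - a ^ 2) = √(1 - a) * √(1 + a) := by
    rw [← Real.sqrt_mul (by linarith)]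
    ring_nf
  have hxa : √(x + a) = √(1 + a) * s := by
    rw [show x + a = (1 + a) * s ^ 2 by linarith, Real.sqrt_mul (by linarith),
      Real.sqrt_sq hs0.le]
  have hrhs : √(1 - a) * (x - 1) / (√(1 - a ^ 2) / a * √(x + a)) = a * (s ^ 2 - 1) / s := by
    rw [hn, hxa]
    field_simp
    rw [hc2, hxs]
    ring
  have hs2 : 0 < s ^ 2 - 1 := by nlinarith
  rw [hrhs, gt_iff_lt, Real.lt_sqrt (by positivity), lt_div_iff₀ (by linarith),
    show x + a = (1 + a) * s ^ 2 by linarith]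
  have hsq : (1 + a * (s ^ 2 - 1) / s) ^ 2 * ((1 + a) * s ^ 2)
      = (s + a * (s ^ 2 - 1)) ^ 2 * (1 + a) := by
    field_simp
  have hgap : 0 < a * ((1 + a) * (s ^ 2 - 1)) * (s - 1) ^ 2 := by
    have : 0 < s - 1 := by linarith
    positivity
  rw [hsq, hxs]
  nlinarith
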